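/- Let d ≥ 1 be an integer and let ā be a real symmetric positive definite d×d matrix. Suppose p, q : ℝ^d → ℝ are polynomials that are homogeneous of degrees m and n respectively with m ≠ n, and that both are ā-harmonic, i.e. Σ_{i,j=1}^d ā_{ij} ∂_{x_i}∂_{x_j} p = 0 and Σ_{i,j=1}^d ā_{ij} ∂_{x_i}∂_{x_j} q = 0. Then for every r > 0, ∫_{{x ∈ ℝ^d : x · ā⁻¹ x < r²}} p(x) q(x) dx = 0. -/

import Mathlib

open MeasureTheory Matrix

theorem MvPolynomial.contDiff_eval {ι : Type*} [Fintype ι] (P : MvPolynomial ι ℝ)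
    {k : WithTop ℕ∞} : ContDiff ℝ k (fun x : ι → ℝ => MvPolynomial.eval x P) := by
  induction P using MvPolynomial.induction_on with
  | C a => simpa using contDiff_const
  | add P Q hP hQ => simpa using hP.add hQ
  | mul_X P i hP => simpa using hP.mul (contDiff_apply ℝ ℝ i)

theorem fderiv_apply_self_of_homogeneous {E : Type*} [NormedAddCommGroup E] [NormedSpace ℝ E]
    {p : E → ℝ} (hp : Differentiable ℝ p) {m : ℕ}
    (h : ∀ t : ℝ, 0 < t → ∀ x, p (t • x) = t ^ m * p x) (x : E) :
    fderiv ℝ p x x = m * p x := by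
  have h1 : HasDerivAt (fun t : ℝ => p (t • x)) (fderiv ℝ p x x) 1 := by
    have hs : HasDerivAt (fun t : ℝ => t • x) x 1 := by
      simpa using (hasDerivAt_id (1 : ℝ)).smul_const x
    have hf : HasFDerivAt p (fderiv ℝ p x) ((1 : ℝ) • x) := by
      simpa using (hp x).hasFDerivAt
    exact hf.comp_hasDerivAt 1 hs
  have h2 : HasDerivAt (fun t : ℝ => t ^ m * p x) (m * p x) 1 := by
    simpa using (hasDerivAt_pow m (1 : ℝ)).mul_const (p x)
  refine h1.unique (h2.congr_of_eventuallyEq ?_)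
  filter_upwards [lt_mem_nhds (zero_lt_one' ℝ)] with t ht using h t ht x

theorem hasDerivAt_max_zero_sq (u : ℝ) :
    HasDerivAt (fun s : ℝ => max s 0 ^ 2) (2 * max u 0) u := by
  rcases lt_trichotomy u 0 with hu | rfl | hu
  · rw [max_eq_right hu.le, mul_zero]
    refine (hasDerivAt_const u (0 : ℝ)).congr_of_eventuallyEq ?_
    filter_upwards [gt_mem_nhds hu] with s hs
    simp [max_eq_right hs.le]
  · have h : (fun s : ℝ => max s 0 ^ 2) =O[nhds 0] fun s : ℝ => ‖s - 0‖ ^ 2 := by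
      refine Asymptotics.IsBigO.of_bound 1 (Filter.Eventually.of_forall fun s => ?_)
      rcases le_total s 0 with hs | hs <;> simp [hs, sq_nonneg]
    simpa using (h.hasFDerivAt one_lt_two).hasDerivAt
  · rw [max_eq_left hu.le]
    have h := hasDerivAt_pow 2 u
    norm_num at h
    refine h.congr_of_eventuallyEq ?_
    filter_upwards [lt_mem_nhds hu] with s hs
    simp [max_eq_left hs.le]

theorem fderiv_eq_sum_single {ι : Type*} [Fintype ι] [DecidableEq ι] (L : (ι → ℝ) →L[ℝ] ℝ)
    (x : ι → ℝ) : L x = ∑ i, x i * L (Pi.single i 1) := by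
  conv_lhs => rw [pi_eq_sum_univ' x]
  simp [map_sum]

section Quadratic

variable {ι : Type*} [Fintype ι]

theorem exists_hasFDerivAt_dotProduct_mulVec {B : Matrix ι ι ℝ} (hB : B.IsHermitian)
    (x : ι → ℝ) : ∃ L : (ι → ℝ) →L[ℝ] ℝ, HasFDerivAt (fun y : ι → ℝ => y ⬝ᵥ B *ᵥ y) L x ∧
      ∀ v, L v = 2 * (v ⬝ᵥ B *ᵥ x) := by
  have h1 (i : ι) : HasFDerivAt (fun y : ι → ℝ => y i)
      (ContinuousLinearMap.proj (R := ℝ) (φ := fun _ : ι => ℝ) i) x :=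
    (ContinuousLinearMap.proj (R := ℝ) (φ := fun _ : ι => ℝ) i).hasFDerivAt
  have h2 (i : ι) : HasFDerivAt (fun y : ι → ℝ => (B *ᵥ y) i)
      ((ContinuousLinearMap.proj (R := ℝ) (φ := fun _ : ι => ℝ) i).comp
        B.mulVecLin.toContinuousLinearMap) x :=
    ((ContinuousLinearMap.proj (R := ℝ) (φ := fun _ : ι => ℝ) i).comp
        B.mulVecLin.toContinuousLinearMap).hasFDerivAt
  refine ⟨_, HasFDerivAt.fun_sum fun i _ => (h1 i).mul (h2 i), fun v => ?_⟩
  have hsymm : x ⬝ᵥ B *ᵥ v = v ⬝ᵥ B *ᵥ x := by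
    have hT : Bᵀ = B := by simpa [IsHermitian, conjTranspose_eq_transpose_of_trivial] using hB
    rw [dotProduct_mulVec, ← mulVec_transpose, hT, dotProduct_comm]
  have : (∑ i, x i * (B *ᵥ v) i) + ∑ i, (B *ᵥ x) i * v i = 2 * (v ⬝ᵥ B *ᵥ x) := by
    have h3 : ∑ i, (B *ᵥ x) i * v i = v ⬝ᵥ B *ᵥ x := by
      rw [dotProduct_comm]; rfl
    rw [h3, two_mul, ← hsymm]; rfl
  simpa [Finset.sum_add_distrib] using this

theorem continuous_dotProduct_mulVec (B : Matrix ι ι ℝ) :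
    Continuous fun x : ι → ℝ => x ⬝ᵥ B *ᵥ x := by
  fun_prop

variable [DecidableEq ι] {A : Matrix ι ι ℝ}

theorem sq_apply_le_diag_mul (hA : A.PosDef) (x : ι → ℝ) (i : ι) :
    x i ^ 2 ≤ A i i * (x ⬝ᵥ A⁻¹ *ᵥ x) := by
  have hu : IsUnit A.det := (Matrix.isUnit_iff_isUnit_det A).1 hA.isUnit
  have hii : 0 < A i i := hA.diag_pos
  have hT : (A⁻¹)ᵀ = A⁻¹ := by
    simpa [IsHermitian, conjTranspose_eq_transpose_of_trivial] using hA.inv.isHermitian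
  have h0 : A⁻¹ *ᵥ (A *ᵥ Pi.single i 1) = Pi.single i 1 := by
    rw [mulVec_mulVec, nonsing_inv_mul _ hu, one_mulVec]
  have h1 : (A *ᵥ Pi.single i 1) ⬝ᵥ A⁻¹ *ᵥ x = x i := by
    rw [dotProduct_mulVec, ← mulVec_transpose, hT, h0, single_one_dotProduct]
  have h2 : (A *ᵥ Pi.single i 1) ⬝ᵥ Pi.single i 1 = A i i := by
    simp
  have key := hA.inv.posSemidef.dotProduct_mulVec_nonneg
    (x - (x i / A i i) • (A *ᵥ Pi.single i 1))
  rw [star_trivial, mulVec_sub, mulVec_smul, h0, sub_dotProduct, dotProduct_sub, dotProduct_sub,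
    smul_dotProduct, smul_dotProduct, dotProduct_smul, dotProduct_smul, h1, h2,
    dotProduct_single_one] at key
  simp only [smul_eq_mul] at key
  rw [div_mul_cancel₀ _ hii.ne', sub_self, sub_zero, sub_nonneg, div_mul_eq_mul_div,
    div_le_iff₀ hii] at key
  linarith

theorem isCompact_dotProduct_inv_mulVec_le (hA : A.PosDef) (R : ℝ) :
    IsCompact {x : ι → ℝ | x ⬝ᵥ A⁻¹ *ᵥ x ≤ R} := by
  refine IsCompact.of_isClosed_subset
    (isCompact_univ_pi fun i => isCompact_Icc (a := -√(A i i * R)) (b := √(A i i * R)))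
    (isClosed_le (continuous_dotProduct_mulVec _) continuous_const) fun x hx i _ => ?_
  have h : x i ^ 2 ≤ A i i * R :=
    (sq_apply_le_diag_mul hA x i).trans (mul_le_mul_of_nonneg_left hx hA.diag_pos.le)
  exact ⟨Real.neg_sqrt_le_of_sq_le h, Real.le_sqrt_of_sq_le h⟩

end Quadratic

theorem contDiff_fderiv_apply {E : Type*} [NormedAddCommGroup E] [NormedSpace ℝ E] {p : E → ℝ}
    (hp : ContDiff ℝ 2 p) (v : E) : ContDiff ℝ 1 fun x => fderiv ℝ p x v :=
  (hp.fderiv_right (by norm_num)).clm_apply contDiff_const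

/-- The flux field `p A∇q - q A∇p` of a pair of functions. -/
noncomputable def greenFlux {ι : Type*} [Fintype ι] [DecidableEq ι] (A : Matrix ι ι ℝ)
    (p q : (ι → ℝ) → ℝ) (i : ι) (x : ι → ℝ) : ℝ :=
  p x * ∑ j, A i j * fderiv ℝ q x (Pi.single j 1) -
    q x * ∑ j, A i j * fderiv ℝ p x (Pi.single j 1)

section Green

variable {ι : Type*} [Fintype ι] [DecidableEq ι] {A : Matrix ι ι ℝ} {p q : (ι → ℝ) → ℝ}

theorem contDiff_greenFlux (hp : ContDiff ℝ 2 p) (hq : ContDiff ℝ 2 q) (i : ι) :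
    ContDiff ℝ 1 (greenFlux A p q i) := by
  unfold greenFlux
  have hp' := hp.of_le (one_le_two)
  have hq' := hq.of_le (one_le_two)
  exact (hp'.mul (ContDiff.sum fun j _ => contDiff_const.mul (contDiff_fderiv_apply hq _))).sub
    (hq'.mul (ContDiff.sum fun j _ => contDiff_const.mul (contDiff_fderiv_apply hp _)))

theorem sum_fderiv_greenFlux (hA : A.IsHermitian) (hp : ContDiff ℝ 2 p) (hq : ContDiff ℝ 2 q)
    {x : ι → ℝ}
    (hph : (∑ i, ∑ j, A i j *
      fderiv ℝ (fun y => fderiv ℝ p y (Pi.single j 1)) x (Pi.single i 1)) = 0)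
    (hqh : (∑ i, ∑ j, A i j *
      fderiv ℝ (fun y => fderiv ℝ q y (Pi.single j 1)) x (Pi.single i 1)) = 0) :
    ∑ i, fderiv ℝ (greenFlux A p q i) x (Pi.single i 1) = 0 := by
  have hsum {f : (ι → ℝ) → ℝ} (hf : ContDiff ℝ 2 f) (i : ι) :
      HasFDerivAt (fun y => ∑ j, A i j * fderiv ℝ f y (Pi.single j 1))
        (∑ j, A i j • fderiv ℝ (fun y => fderiv ℝ f y (Pi.single j 1)) x) x :=
    HasFDerivAt.fun_sum fun j _ =>
      (((contDiff_fderiv_apply hf _).differentiable one_ne_zero x).hasFDerivAt).const_mul _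
  have hd {f : (ι → ℝ) → ℝ} (hf : ContDiff ℝ 2 f) : HasFDerivAt f (fderiv ℝ f x) x :=
    (hf.differentiable two_ne_zero x).hasFDerivAt
  have h (i : ι) : fderiv ℝ (greenFlux A p q i) x (Pi.single i 1) =
      p x * (∑ j, A i j * fderiv ℝ (fun y => fderiv ℝ q y (Pi.single j 1)) x (Pi.single i 1)) -
      q x * (∑ j, A i j * fderiv ℝ (fun y => fderiv ℝ p y (Pi.single j 1)) x (Pi.single i 1)) +
      ((∑ j, A i j * (fderiv ℝ q x (Pi.single j 1) * fderiv ℝ p x (Pi.single i 1))) -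
      ∑ j, A i j * (fderiv ℝ p x (Pi.single j 1) * fderiv ℝ q x (Pi.single i 1))) := by
    have := (((hd hp).mul (hsum hq i)).sub ((hd hq).mul (hsum hp i))).fderiv
    rw [show greenFlux A p q i = _ from funext fun y => rfl]
    erw [this]
    simp only [_root_.sub_apply, _root_.add_apply,
      _root_.smul_apply, _root_.sum_apply, smul_eq_mul, Finset.sum_mul,
      ← mul_assoc]
    ring
  have hsymm : ∑ i, ∑ j, A i j * (fderiv ℝ p x (Pi.single j 1) * fderiv ℝ q x (Pi.single i 1)) =
      ∑ i, ∑ j, A i j * (fderiv ℝ q x (Pi.single j 1) * fderiv ℝ p x (Pi.single i 1)) := by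
    rw [Finset.sum_comm]
    refine Finset.sum_congr rfl fun i _ => Finset.sum_congr rfl fun j _ => ?_
    rw [← hA.apply i j, star_trivial, mul_comm (fderiv ℝ p x _)]
  simp only [h, Finset.sum_add_distrib, Finset.sum_sub_distrib, ← Finset.mul_sum, hph, hqh, hsymm]
  ring

/-- Pairing the flux with `A⁻¹ x` gives the difference of the radial derivatives. -/
theorem sum_mulVec_inv_mul_greenFlux (hA : A.PosDef) (x : ι → ℝ) :
    ∑ i, (A⁻¹ *ᵥ x) i * greenFlux A p q i x = p x * fderiv ℝ q x x - q x * fderiv ℝ p x x := by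
  have hu : IsUnit A.det := (Matrix.isUnit_iff_isUnit_det A).1 hA.isUnit
  have hT : Aᵀ = A := by
    simpa [IsHermitian, conjTranspose_eq_transpose_of_trivial] using hA.isHermitian
  have h (L : (ι → ℝ) →L[ℝ] ℝ) :
      ∑ i, (A⁻¹ *ᵥ x) i * ∑ j, A i j * L (Pi.single j 1) = L x := by
    change (A⁻¹ *ᵥ x) ⬝ᵥ A *ᵥ (fun j => L (Pi.single j 1)) = _
    rw [dotProduct_mulVec, ← mulVec_transpose, hT, mulVec_mulVec, mul_nonsing_inv _ hu,
      one_mulVec, fderiv_eq_sum_single L x]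
    rfl
  simp only [greenFlux, mul_sub, Finset.sum_sub_distrib, mul_left_comm _ (p x),
    mul_left_comm _ (q x), ← Finset.mul_sum, h]

theorem hasCompactSupport_max_sub_dotProduct (hA : A.PosDef) (R : ℝ) :
    HasCompactSupport fun x : ι → ℝ => max (R - x ⬝ᵥ A⁻¹ *ᵥ x) 0 := by
  refine HasCompactSupport.intro (isCompact_dotProduct_inv_mulVec_le hA R) fun x hx => ?_
  exact max_eq_right (sub_nonpos.2 (not_le.1 hx).le)

theorem integral_max_sub_mul_eq_zero (hA : A.PosDef) (hp : ContDiff ℝ 2 p) (hq : ContDiff ℝ 2 q)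
    (hph : ∀ x : ι → ℝ, (∑ i, ∑ j, A i j *
      fderiv ℝ (fun y => fderiv ℝ p y (Pi.single j 1)) x (Pi.single i 1)) = 0)
    (hqh : ∀ x : ι → ℝ, (∑ i, ∑ j, A i j *
      fderiv ℝ (fun y => fderiv ℝ q y (Pi.single j 1)) x (Pi.single i 1)) = 0)
    {m n : ℕ} (hmn : m ≠ n) (hpm : ∀ x, fderiv ℝ p x x = m * p x)
    (hqn : ∀ x, fderiv ℝ q x x = n * q x) (R : ℝ) :
    ∫ x : ι → ℝ, max (R - x ⬝ᵥ A⁻¹ *ᵥ x) 0 * (p x * q x) = 0 := by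
  set c : (ι → ℝ) → ℝ := fun x => max (R - x ⬝ᵥ A⁻¹ *ᵥ x) 0 with hc
  have hcc : Continuous c := (continuous_const.sub (continuous_dotProduct_mulVec _)).max
    continuous_const
  have hcs : HasCompactSupport c := hasCompactSupport_max_sub_dotProduct hA R
  have hw (x : ι → ℝ) : DifferentiableAt ℝ (fun y => c y ^ 2) x ∧
      ∀ i, fderiv ℝ (fun y => c y ^ 2) x (Pi.single i 1) = -4 * (c x * (A⁻¹ *ᵥ x) i) := by
    obtain ⟨L, hL, hLv⟩ := exists_hasFDerivAt_dotProduct_mulVec hA.inv.isHermitian x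
    have h := (hasDerivAt_max_zero_sq (R - x ⬝ᵥ A⁻¹ *ᵥ x)).comp_hasFDerivAt x
      (hL.const_sub R)
    have h' : HasFDerivAt (fun y => c y ^ 2) _ x := h
    refine ⟨h'.differentiableAt, fun i => ?_⟩
    rw [h'.fderiv]
    simp only [_root_.smul_apply, _root_.neg_apply, hLv, smul_eq_mul,
      single_one_dotProduct, hc]
    ring
  have hV (i : ι) := contDiff_greenFlux (A := A) hp hq i
  have hVc (i : ι) : Continuous (greenFlux A p q i) := (hV i).continuous
  have hVd (i : ι) : Continuous fun x => fderiv ℝ (greenFlux A p q i) x (Pi.single i 1) :=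
    ((hV i).continuous_fderiv one_ne_zero).clm_apply continuous_const
  have hAx (i : ι) : Continuous fun x : ι → ℝ => (A⁻¹ *ᵥ x) i := by fun_prop
  have int1 (i : ι) : Integrable fun x => c x * ((A⁻¹ *ᵥ x) i * greenFlux A p q i x) :=
    (hcc.mul ((hAx i).mul (hVc i))).integrable_of_hasCompactSupport hcs.mul_right
  have hsq : HasCompactSupport fun x => c x ^ 2 := by
    have h : (fun x => c x ^ 2) = c * c := funext fun x => sq (c x)
    exact h ▸ hcs.mul_right
  have int2 (i : ι) : Integrable fun x =>
      c x ^ 2 * fderiv ℝ (greenFlux A p q i) x (Pi.single i 1) :=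
    ((hcc.pow 2).mul (hVd i)).integrable_of_hasCompactSupport hsq.mul_right
  have int3 (i : ι) : Integrable fun x => c x ^ 2 * greenFlux A p q i x :=
    ((hcc.pow 2).mul (hVc i)).integrable_of_hasCompactSupport hsq.mul_right
  have parts (i : ι) :
      ∫ x, c x ^ 2 * fderiv ℝ (greenFlux A p q i) x (Pi.single i 1) =
        4 * ∫ x, c x * ((A⁻¹ *ᵥ x) i * greenFlux A p q i x) := by
    have hrw : (fun x => fderiv ℝ (fun y => c y ^ 2) x (Pi.single i 1) * greenFlux A p q i x) =
        fun x => -4 * (c x * ((A⁻¹ *ᵥ x) i * greenFlux A p q i x)) := by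
      funext x
      rw [(hw x).2 i]
      ring
    rw [integral_mul_fderiv_eq_neg_fderiv_mul_of_integrable (by rw [hrw]; exact (int1 i).const_mul _)
      (int2 i) (int3 i) (fun x _ => (hw x).1) (fun x _ => (hV i).differentiable one_ne_zero x),
      hrw, integral_const_mul]
    ring
  have hsum : (0 : ℝ) = 4 * ∫ x, ∑ i, c x * ((A⁻¹ *ᵥ x) i * greenFlux A p q i x) := by
    rw [integral_finsetSum _ fun i _ => int1 i, Finset.mul_sum]
    simp only [← parts]
    rw [← integral_finsetSum _ fun i _ => int2 i]
    simp only [← Finset.mul_sum, sum_fderiv_greenFlux hA.isHermitian hp hq (hph _) (hqh _),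
      mul_zero, integral_zero]
  have hfin : (fun x => ∑ i, c x * ((A⁻¹ *ᵥ x) i * greenFlux A p q i x)) =
      fun x => ((n : ℝ) - m) * (c x * (p x * q x)) := by
    funext x
    rw [← Finset.mul_sum, sum_mulVec_inv_mul_greenFlux hA, hpm, hqn]
    ring
  rw [hfin, integral_const_mul] at hsum
  have hne : (n : ℝ) - m ≠ 0 := sub_ne_zero.2 (by exact_mod_cast hmn.symm)
  simpa [hne] using hsum.symm

end Green

theorem setIntegral_eq_zero_of_integral_max_sub_mul_eq_zero {X : Type*} [TopologicalSpace X] [T2Space X]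
    [MeasurableSpace X] [OpensMeasurableSpace X] {μ : Measure X} [IsFiniteMeasureOnCompacts μ]
    {N f : X → ℝ} (hN : Continuous N) (hNc : ∀ R, IsCompact {x | N x ≤ R}) (hf : Continuous f)
    (h : ∀ R, ∫ x, max (R - N x) 0 * f x ∂μ = 0) (R : ℝ) :
    ∫ x in {x | N x < R}, f x ∂μ = 0 := by
  have hms : MeasurableSet {x | N x < R} := (isOpen_lt hN continuous_const).measurableSet
  have hint (S : ℝ) : Integrable (fun x => max (S - N x) 0 * f x) μ :=
    ((continuous_const.sub hN).max continuous_const |>.mul hf).integrable_of_hasCompactSupport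
      (HasCompactSupport.intro (hNc S) fun x hx => by
        exact mul_eq_zero_of_left (max_eq_right (sub_nonpos.2 (not_le.1 hx).le)) _)
  let F (k : ℕ) (x : X) : ℝ :=
    ((k : ℝ) + 1) * (max (R - N x) 0 * f x - max (R - 1 / ((k : ℝ) + 1) - N x) 0 * f x)
  have hF (k : ℕ) : ∫ x, F k x ∂μ = 0 := by
    rw [integral_const_mul, integral_sub (hint _) (hint _), h, h, sub_zero, mul_zero]
  rw [← integral_indicator hms]
  have hlim : Filter.Tendsto (fun k => ∫ x, F k x ∂μ) Filter.atTop
      (nhds (∫ x, {x | N x < R}.indicator f x ∂μ)) := by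
    refine tendsto_integral_of_dominated_convergence
      ({x | N x < R}.indicator fun x => |f x|) (fun k => ?_) ?_ (fun k => ?_) ?_
    · exact (((hint _).sub (hint _)).const_mul _).aestronglyMeasurable
    · rw [integrable_indicator_iff hms]
      exact (hf.abs.continuousOn.integrableOn_compact (hNc R)).mono_set fun x hx => le_of_lt (Set.mem_ofPred_eq ▸ hx)
    · refine Filter.Eventually.of_forall fun x => ?_
      have hk : (0 : ℝ) < (k : ℝ) + 1 := by positivity
      have hk' : 0 < 1 / ((k : ℝ) + 1) := by positivity
      by_cases hx : N x < R
      · rw [Set.indicator_of_mem (show x ∈ {x | N x < R} from hx)]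
        have h0 : 0 ≤ max (R - N x) 0 - max (R - 1 / ((k : ℝ) + 1) - N x) 0 :=
          sub_nonneg.2 (max_le_max (by linarith) le_rfl)
        have h1 : max (R - N x) 0 - max (R - 1 / ((k : ℝ) + 1) - N x) 0 ≤ 1 / ((k : ℝ) + 1) := by
          rw [max_eq_left (by linarith : 0 ≤ R - N x)]
          linarith [le_max_left (R - 1 / ((k : ℝ) + 1) - N x) 0]
        simp only [F, ← sub_mul]
        rw [← mul_assoc, norm_mul, Real.norm_eq_abs, Real.norm_eq_abs,
          abs_of_nonneg (mul_nonneg hk.le h0)]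
        refine mul_le_of_le_one_left (abs_nonneg _) ?_
        rwa [le_div_iff₀ hk, mul_comm] at h1
      · rw [Set.indicator_of_notMem (show x ∉ {x | N x < R} from hx)]
        simp only [F]
        rw [max_eq_right (by linarith), max_eq_right (by linarith)]
        simp
    · refine Filter.Eventually.of_forall fun x => ?_
      refine tendsto_const_nhds.congr' ?_
      by_cases hx : N x < R
      · have := tendsto_one_div_add_atTop_nhds_zero_nat (𝕜 := ℝ)
        filter_upwards [this.eventually_lt_const (sub_pos.2 hx)] with k hk
        rw [Set.indicator_of_mem (show x ∈ {x | N x < R} from hx)]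
        simp only [F]
        rw [max_eq_left (by linarith), max_eq_left (by linarith)]
        field_simp
        ring
      · refine Filter.Eventually.of_forall fun k => ?_
        have hk' : 0 < 1 / ((k : ℝ) + 1) := by positivity
        rw [Set.indicator_of_notMem (show x ∉ {x | N x < R} from hx)]
        simp only [F]
        rw [max_eq_right (by linarith), max_eq_right (by linarith)]
        simp
  simp only [hF] at hlim
  exact tendsto_nhds_unique hlim tendsto_const_nhds

/-- Let `d ≥ 1` and let `ā` be a real symmetric positive definite `d×d` matrix. If
`p, q : ℝ^d → ℝ` are polynomials, homogeneous of degrees `m ≠ n` respectively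
(`p(tx) = t^m p(x)` for all `t > 0`), and both are `ā`-harmonic
(`∑_{ij} ā_{ij} ∂_i ∂_j p = 0` and likewise for `q`), then for every `r > 0`,
`∫_{{x : x · ā⁻¹ x < r²}} p(x) q(x) dx = 0`. -/
theorem stmt_18 (d : ℕ) (hd : 1 ≤ d) (A : Matrix (Fin d) (Fin d) ℝ) (hA : A.PosDef)
    (m n : ℕ) (hmn : m ≠ n) (p q : (Fin d → ℝ) → ℝ)
    (hp : ∃ P : MvPolynomial (Fin d) ℝ, ∀ x, p x = MvPolynomial.eval x P)
    (hq : ∃ Q : MvPolynomial (Fin d) ℝ, ∀ x, q x = MvPolynomial.eval x Q)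
    (hpm : ∀ t : ℝ, 0 < t → ∀ x, p (t • x) = t ^ m * p x)
    (hqn : ∀ t : ℝ, 0 < t → ∀ x, q (t • x) = t ^ n * q x)
    (hph : ∀ x : Fin d → ℝ,
      (∑ i, ∑ j, A i j *
        fderiv ℝ (fun y => fderiv ℝ p y (Pi.single j 1)) x (Pi.single i 1)) = 0)
    (hqh : ∀ x : Fin d → ℝ,
      (∑ i, ∑ j, A i j *
        fderiv ℝ (fun y => fderiv ℝ q y (Pi.single j 1)) x (Pi.single i 1)) = 0)
    (r : ℝ) (hr : 0 < r) :
    (∫ x in {x : Fin d → ℝ | x ⬝ᵥ A⁻¹.mulVec x < r ^ 2}, p x * q x) = 0 := by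
  obtain ⟨P, hP⟩ := hp
  obtain ⟨Q, hQ⟩ := hq
  have hp2 : ContDiff ℝ 2 p := funext hP ▸ P.contDiff_eval
  have hq2 : ContDiff ℝ 2 q := funext hQ ▸ Q.contDiff_eval
  refine setIntegral_eq_zero_of_integral_max_sub_mul_eq_zero (continuous_dotProduct_mulVec _)
    (isCompact_dotProduct_inv_mulVec_le hA) (hp2.continuous.mul hq2.continuous) (fun R => ?_) _
  exact integral_max_sub_mul_eq_zero hA hp2 hq2 hph hqh hmn
    (fderiv_apply_self_of_homogeneous (hp2.differentiable two_ne_zero) hpm)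
    (fderiv_apply_self_of_homogeneous (hq2.differentiable two_ne_zero) hqn) R
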